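/- Over the distributed alphabet Σ₁={a,b,c}, Σ₂={a,d,e}, the language L_s = Lang((abd+adb+ace+aec)*·(1+a)) cannot be expressed as a finite union of direct product languages over this distribution (equivalently, L_s is not a synchronous product language). -/

import Mathlib

open scoped Computability

/-- The five-letter alphabet `{a,b,c,d,e}`, distributed as `Σ₁ = {a,b,c}`,
`Σ₂ = {a,d,e}`. -/
inductive Ltr : Type
  | a | b | c | d | e
deriving DecidableEq

open Ltr

/-- Projection of a word to `Σ₁ = {a,b,c}`. -/
def proj1 (w : List Ltr) : List Ltr := w.filter (fun x => decide (x = a ∨ x = b ∨ x = c))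

/-- Projection of a word to `Σ₂ = {a,d,e}`. -/
def proj2 (w : List Ltr) : List Ltr := w.filter (fun x => decide (x = a ∨ x = d ∨ x = e))

/-- A language over the distribution `(Σ₁, Σ₂)` is a direct product language iff it
equals the set of words each of whose projections agrees with the projection of some
word of the language. -/
def IsDirectProduct (L : Language Ltr) : Prop :=
  L = {w | (∃ u ∈ L, proj1 w = proj1 u) ∧ (∃ u ∈ L, proj2 w = proj2 u)}

/-- The language `L_s = (abd+adb+ace+aec)∗ · (1 + a)`. -/
def Ls : Language Ltr :=
  (({[a,b,d],[a,d,b],[a,c,e],[a,e,c]} : Language Ltr))∗ * (1 + ({[a]} : Language Ltr))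

/-- The word of `n` blocks whose `k`-th block is `a`, followed by `b` if `k < p` and `c` otherwise,
followed by `d` if `k < q` and `e` otherwise. -/
def blockWord (n p q : ℕ) : List Ltr :=
  (List.range n).flatMap fun k => [a, if k < p then b else c, if k < q then d else e]

theorem proj1_blockWord (n p q q' : ℕ) :
    proj1 (blockWord n p q) = proj1 (blockWord n p q') := by
  simp only [proj1, blockWord, List.filter_flatMap]
  congr 1
  funext k
  split_ifs <;> simp

theorem proj2_blockWord (n p p' q : ℕ) :
    proj2 (blockWord n p q) = proj2 (blockWord n p' q) := by
  simp only [proj2, blockWord, List.filter_flatMap]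
  congr 1
  funext k
  split_ifs <;> simp

theorem blockWord_succ (n p q : ℕ) :
    blockWord (n + 1) p q =
      blockWord n p q ++ [a, if n < p then b else c, if n < q then d else e] := by
  simp [blockWord, List.range_succ]

theorem count_b_blockWord (n p q : ℕ) : (blockWord n p q).count b = min n p := by
  induction n with
  | zero => simp [blockWord]
  | succ n ih =>
    rw [blockWord_succ, List.count_append, ih]
    split_ifs <;> simp <;> omega

theorem count_d_blockWord (n p q : ℕ) : (blockWord n p q).count d = min n q := by
  induction n with
  | zero => simp [blockWord]
  | succ n ih =>
    rw [blockWord_succ, List.count_append, ih]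
    split_ifs <;> simp <;> omega

theorem blockWord_mem_Ls (n p : ℕ) : blockWord n p p ∈ Ls := by
  refine Language.mem_mul.2 ⟨blockWord n p p, ?_, [], Or.inl rfl, List.append_nil _⟩
  refine Language.mem_kstar.2
    ⟨(List.range n).map fun k => [a, if k < p then b else c, if k < p then d else e], rfl, ?_⟩
  intro y hy
  obtain ⟨k, -, rfl⟩ := List.mem_map.1 hy
  split_ifs
  · exact Or.inl rfl
  · exact Or.inr (Or.inr (Or.inl rfl))

theorem count_b_eq_count_d_of_mem_Ls {w : List Ltr} (hw : w ∈ Ls) : w.count b = w.count d := by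
  obtain ⟨u, hu, v, hv, rfl⟩ := Language.mem_mul.1 hw
  obtain ⟨S, rfl, hS⟩ := Language.mem_kstar.1 hu
  have hv' : v.count b = v.count d := by
    rcases hv with rfl | rfl <;> rfl
  have hS' : S.map (List.count b) = S.map (List.count d) := by
    refine List.map_congr_left fun y hy => ?_
    rcases hS y hy with rfl | rfl | rfl | rfl <;> rfl
  rw [List.count_append, List.count_append, hv', List.count_flatten, List.count_flatten, hS']

/-- Over the distribution `Σ₁ = {a,b,c}`, `Σ₂ = {a,d,e}`, the
language `L_s` cannot be expressed as a finite union of direct product languages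
(equivalently, `L_s` is not a synchronous product language). -/
theorem Ls_not_finite_union_of_direct_products :
    ¬ ∃ (n : ℕ) (Lu : Fin n → Language Ltr),
        (∀ j, IsDirectProduct (Lu j)) ∧ (∀ w, w ∈ Ls ↔ ∃ j, w ∈ Lu j) := by
  rintro ⟨n, Lu, hdir, hunion⟩
  choose f hf using fun p : Fin (n + 1) => (hunion _).1 (blockWord_mem_Ls n p)
  obtain ⟨p, q, hpq, hfpq⟩ := Fintype.exists_ne_map_eq_of_card_lt f (by simp)
  have hmix : blockWord n p q ∈ Lu (f p) := by
    rw [hdir (f p)]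
    exact ⟨⟨_, hf p, proj1_blockWord n p q p⟩, ⟨_, hfpq ▸ hf q, proj2_blockWord n p q q⟩⟩
  have hcount := count_b_eq_count_d_of_mem_Ls ((hunion _).2 ⟨_, hmix⟩)
  rw [count_b_blockWord, count_d_blockWord] at hcount
  omega
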